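/- arXiv:2506.00529 — 2 statements merged into one kernel-verified Lean document; each statement's English description precedes it below -/
import Mathlib

section
/- Let R be a commutative Noetherian ring, r ≥ 1 an integer, and I_1,…,I_r ideals of R. Let T be an R-module and let U, V, W be finitely generated submodules of T with W ⊆ V. For n ∈ ℕ^r set L_n := (U + I^n V)/(I^n W) (note I^n W ⊆ I^n V ⊆ U + I^n V). If the length λ_R(L_n) is finite for all n ≫ 0, then there exist c ∈ ℕ^r and a polynomial P ∈ ℚ[x_1,…,x_r] such that λ_R(L_n) = P(n) for all n ≥ c. -/
/-- The product ideal `I^n = I_1^{n_1} ⋯ I_r^{n_r}`. -/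
abbrev prodPow {R : Type*} [CommRing R] {r : ℕ} (I : Fin r → Ideal R)
    (n : Fin r → ℕ) : Ideal R :=
  ∏ i, I i ^ n i

/-- The length `λ_R(X)` of an `R`-module `X`, as the supremum of lengths of chains
of submodules of `X` (an element of `WithBot ℕ∞`; it is `⊤` iff `X` has infinite
length). -/
noncomputable def moduleLength (R X : Type*) [CommRing R] [AddCommGroup X]
    [Module R X] : WithBot ℕ∞ :=
  Order.krullDim (Submodule R X)

/-! ### Eventually polynomial functions -/

/-- Polynomial functions on tuples. -/
def IsPolyFun {r : ℕ} (F : (Fin r → ℕ) → ℚ) : Prop :=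
  ∃ P : MvPolynomial (Fin r) ℚ, ∀ n, F n = MvPolynomial.eval (fun i => (n i : ℚ)) P

/-- Eventually polynomial functions on tuples. -/
def EvPoly {r : ℕ} (H : (Fin r → ℕ) → ℚ) : Prop :=
  ∃ (c : Fin r → ℕ) (F : (Fin r → ℕ) → ℚ), IsPolyFun F ∧ ∀ n, c ≤ n → H n = F n

namespace IsPolyFun
variable {r : ℕ} {F G : (Fin r → ℕ) → ℚ}

lemma const (a : ℚ) : IsPolyFun (fun _ : Fin r → ℕ => a) := ⟨MvPolynomial.C a, by simp⟩
lemma coord (i : Fin r) : IsPolyFun (fun n : Fin r → ℕ => (n i : ℚ)) :=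
  ⟨MvPolynomial.X i, by simp⟩
lemma add (hF : IsPolyFun F) (hG : IsPolyFun G) : IsPolyFun (fun n => F n + G n) := by
  obtain ⟨P, hP⟩ := hF
  obtain ⟨Q, hQ⟩ := hG
  exact ⟨P + Q, by simp [hP, hQ]⟩
lemma sub (hF : IsPolyFun F) (hG : IsPolyFun G) : IsPolyFun (fun n => F n - G n) := by
  obtain ⟨P, hP⟩ := hF
  obtain ⟨Q, hQ⟩ := hG
  exact ⟨P - Q, by simp [hP, hQ]⟩
lemma mul (hF : IsPolyFun F) (hG : IsPolyFun G) : IsPolyFun (fun n => F n * G n) := by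
  obtain ⟨P, hP⟩ := hF
  obtain ⟨Q, hQ⟩ := hG
  exact ⟨P * Q, by simp [hP, hQ]⟩
/-- substitution -/
lemma comp (hF : IsPolyFun F) (g : (Fin r → ℕ) → (Fin r → ℕ))
    (hg : ∀ i, IsPolyFun (fun n => (g n i : ℚ))) : IsPolyFun (fun n => F (g n)) := by
  obtain ⟨P, hP⟩ := hF
  choose Q hQ using hg
  refine ⟨MvPolynomial.bind₁ Q P, fun n => ?_⟩
  beta_reduce
  have h := MvPolynomial.eval₂Hom_bind₁ (RingHom.id ℚ) (fun i => (n i : ℚ)) Q P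
  rw [hP]
  refine Eq.trans ?_ h.symm
  congr 2
  funext i
  exact hQ i n

lemma update (hF : IsPolyFun F) (i : Fin r) (k : ℕ) :
    IsPolyFun (fun n => F (Function.update n i k)) := by
  refine hF.comp _ fun j => ?_
  by_cases h : j = i
  · subst h; simpa using const (k : ℚ)
  · simpa [Function.update_of_ne h] using coord j

/-- univariate polynomials in one coordinate -/
lemma polyCoord (p : Polynomial ℚ) (i : Fin r) :
    IsPolyFun (fun n : Fin r → ℕ => p.eval (n i : ℚ)) := by
  refine ⟨Polynomial.aeval (MvPolynomial.X i) p, fun n => ?_⟩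
  have := Polynomial.hom_eval₂ p (algebraMap ℚ (MvPolynomial (Fin r) ℚ))
    (MvPolynomial.eval (fun i => (n i : ℚ))) (MvPolynomial.X i)
  rw [Polynomial.aeval_def, this]
  simp only [MvPolynomial.eval_X, Polynomial.eval]
  congr 1
  ext x; simp

lemma exists_sum_pow (m : ℕ) : ∃ p : Polynomial ℚ, ∀ n : ℕ,
    ∑ k ∈ Finset.range n, (k : ℚ) ^ m = p.eval (n : ℚ) := by
  refine ⟨Polynomial.C (1 / ((m : ℚ) + 1)) *
    (Polynomial.bernoulli m.succ - Polynomial.C (bernoulli m.succ)), fun n => ?_⟩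
  have := Polynomial.sum_range_pow_eq_bernoulli_sub n m
  have h : (m : ℚ) + 1 ≠ 0 := by positivity
  simp only [Polynomial.eval_mul, Polynomial.eval_C, Polynomial.eval_sub]
  rw [← this]
  field_simp

lemma sum (hF : IsPolyFun F) (i : Fin r) :
    IsPolyFun (fun n => ∑ k ∈ Finset.range (n i), F (Function.update n i k)) := by
  obtain ⟨P, hP⟩ := hF
  have hF : F = fun n => MvPolynomial.eval (fun i => (n i : ℚ)) P := funext hP
  subst hF
  clear hP
  induction P using MvPolynomial.induction_on' with
  | add p q hp hq => simpa [Finset.sum_add_distrib] using hp.add hq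
  | monomial u a =>
    obtain ⟨p, hp⟩ := exists_sum_pow (u i)
    have h1 : IsPolyFun (fun n : Fin r → ℕ => MvPolynomial.eval (fun i => (n i : ℚ))
      (MvPolynomial.monomial (u.erase i) a)) := ⟨_, fun _ => rfl⟩
    have := h1.mul (polyCoord p i)
    refine (congrArg IsPolyFun (funext fun n => ?_)).mp this
    rw [← hp, Finset.mul_sum]
    refine Finset.sum_congr rfl fun k _ => ?_
    simp only [MvPolynomial.eval_monomial, mul_assoc]
    congr 1
    rw [Finsupp.prod_fintype _ _ (by simp), Finsupp.prod_fintype _ _ (by simp),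
      ← Finset.mul_prod_erase _ _ (Finset.mem_univ i),
      ← Finset.mul_prod_erase _ _ (Finset.mem_univ i)]
    simp only [Finsupp.erase_same, pow_zero, one_mul, Function.update_self]
    rw [mul_comm]
    congr 1
    refine Finset.prod_congr rfl fun j hj => ?_
    have hj := Finset.ne_of_mem_erase hj
    rw [Finsupp.erase_ne hj, Function.update_of_ne hj]

end IsPolyFun

namespace EvPoly
variable {r : ℕ} {F G : (Fin r → ℕ) → ℚ}

lemma congr' (hF : EvPoly F) (c : Fin r → ℕ) (h : ∀ n, c ≤ n → G n = F n) : EvPoly G := by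
  obtain ⟨c', P, hP, h'⟩ := hF
  exact ⟨c ⊔ c', P, hP, fun n hn => (h n (le_sup_left.trans hn)).trans
    (h' n (le_sup_right.trans hn))⟩
lemma add (hF : EvPoly F) (hG : EvPoly G) : EvPoly (fun n => F n + G n) := by
  obtain ⟨c, P, hP, h⟩ := hF
  obtain ⟨c', P', hP', h'⟩ := hG
  exact ⟨c ⊔ c', _, hP.add hP', fun n hn => by
    beta_reduce
    rw [h n (le_sup_left.trans hn), h' n (le_sup_right.trans hn)]⟩
lemma sub (hF : EvPoly F) (hG : EvPoly G) : EvPoly (fun n => F n - G n) := by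
  obtain ⟨c, P, hP, h⟩ := hF
  obtain ⟨c', P', hP', h'⟩ := hG
  exact ⟨c ⊔ c', _, hP.sub hP', fun n hn => by
    beta_reduce
    rw [h n (le_sup_left.trans hn), h' n (le_sup_right.trans hn)]⟩
lemma shift (hF : EvPoly F) (e : Fin r → ℕ) : EvPoly (fun n => F (n + e)) := by
  obtain ⟨c, P, hP, h⟩ := hF
  refine ⟨c, fun n => P (n + e), hP.comp _ fun i => ?_,
    fun n hn => h _ (hn.trans (le_add_of_nonneg_right (zero_le)))⟩
  simpa using (IsPolyFun.coord i).add (IsPolyFun.const (e i : ℚ))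

lemma of_diff (H : (Fin r → ℕ) → ℚ)
    (hH : ∀ i, EvPoly (fun n => H (n + Pi.single i 1) - H n)) : EvPoly H := by
  choose c' P hP h using hH
  set c : Fin r → ℕ := Finset.univ.sup c' with hc
  have hcc : ∀ i, c' i ≤ c := fun i => Finset.le_sup (Finset.mem_univ i)
  have key : ∀ i, ∃ Q, IsPolyFun Q ∧
      ∀ n, c ≤ n → H n = H (Function.update n i (c i)) + Q n := by
    intro i
    refine ⟨_, ((hP i).sum i).sub (((hP i).sum i).update i (c i)), ?_⟩
    have aux : ∀ n, c ≤ n → ∀ k, H (Function.update n i (c i + k)) =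
        H (Function.update n i (c i)) +
        (∑ k ∈ Finset.range (c i + k), P i (Function.update n i k) -
          ∑ k ∈ Finset.range (c i), P i (Function.update n i k)) := by
      intro n hn k
      induction k with
      | zero => simp
      | succ k ih =>
        rw [← add_assoc, Finset.sum_range_succ]
        have := h i (Function.update n i (c i + k)) ((hcc i).trans (by
          intro j
          by_cases hj : j = i
          · subst hj; simp
          · simpa [Function.update_of_ne hj] using hn j))
        have e : Function.update n i (c i + k) + Pi.single i 1 =
            Function.update n i (c i + k + 1) := by
          ext j
          by_cases hj : j = i
          · subst hj; simp
          · simp [Function.update_of_ne hj, Pi.single_eq_of_ne hj]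
        beta_reduce at this
        rw [e] at this
        linarith
    intro n hn
    obtain ⟨k, hk⟩ := Nat.exists_eq_add_of_le (hn i)
    have := aux n hn k
    rw [← hk, Function.update_eq_self] at this
    simpa using this
  have key2 : ∀ s : Finset (Fin r), ∃ Q, IsPolyFun Q ∧
      ∀ n, c ≤ n → H n = H (s.piecewise c n) + Q n := by
    intro s
    induction s using Finset.induction_on with
    | empty => exact ⟨_, IsPolyFun.const 0, by simp⟩
    | insert i s his ih =>
      obtain ⟨Q, hQ, hh⟩ := ih
      obtain ⟨Q', hQ', hh'⟩ := key i
      refine ⟨_, (hQ'.comp (fun n => s.piecewise c n) fun j => ?_).add hQ, fun n hn => ?_⟩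
      · by_cases hj : j ∈ s
        · simpa [hj] using IsPolyFun.const (c j : ℚ)
        · simpa [hj] using IsPolyFun.coord j
      · rw [hh n hn, hh' _ (Finset.le_piecewise_of_le_of_le _ le_rfl hn), Finset.piecewise_insert]
        ring
  obtain ⟨Q, hQ, hh⟩ := key2 Finset.univ
  exact ⟨c, _, (IsPolyFun.const (H c)).add hQ, fun n hn => by simpa using hh n hn⟩

end EvPoly

/-! ### Relative length -/

section RelLength
variable {R T : Type*} [CommRing R] [AddCommGroup T] [Module R T]

/-- The length of `A / (A ∩ B)`. -/
noncomputable def relLen (B A : Submodule R T) : ℕ∞ :=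
  Module.length R (↥A ⧸ Submodule.comap A.subtype B)

lemma relLen_add {B C A : Submodule R T} (hBC : B ≤ C) (hCA : C ≤ A) :
    relLen B A = relLen B C + relLen C A := by
  let f : (↥C ⧸ Submodule.comap C.subtype B) →ₗ[R] (↥A ⧸ Submodule.comap A.subtype B) :=
    Submodule.mapQ _ _ (Submodule.inclusion hCA) (fun x hx => hx)
  let g : (↥A ⧸ Submodule.comap A.subtype B) →ₗ[R] (↥A ⧸ Submodule.comap A.subtype C) :=
    Submodule.mapQ _ _ LinearMap.id (fun x hx => hBC hx)
  refine Module.length_eq_add_of_exact f g ?_ ?_ ?_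
  · rw [injective_iff_map_eq_zero]
    intro x
    obtain ⟨x, rfl⟩ := Submodule.mkQ_surjective _ x
    intro h
    have h : Submodule.Quotient.mk (Submodule.inclusion hCA x) =
      (0 : ↥A ⧸ Submodule.comap A.subtype B) := h
    rw [Submodule.Quotient.mk_eq_zero] at h
    exact (Submodule.Quotient.mk_eq_zero _).mpr h
  · intro x
    obtain ⟨x, rfl⟩ := Submodule.mkQ_surjective _ x
    exact ⟨Submodule.Quotient.mk x, by simp [g]⟩
  · intro x
    obtain ⟨x, rfl⟩ := Submodule.mkQ_surjective _ x
    constructor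
    · intro h
      have h : (x : T) ∈ C := by simpa [g] using h
      exact ⟨Submodule.Quotient.mk ⟨x, h⟩, rfl⟩
    · rintro ⟨y, hy⟩
      obtain ⟨y, rfl⟩ := Submodule.mkQ_surjective _ y
      rw [← hy]
      exact (Submodule.Quotient.mk_eq_zero _).mpr y.2

lemma relLen_map (f : T →ₗ[R] T) (B A : Submodule R T) :
    relLen (A ⊓ B.comap f) A = relLen B (B ⊔ A.map f) := by
  let g : ↥A →ₗ[R] ↥(B ⊔ A.map f) :=
    LinearMap.codRestrict _ (f ∘ₗ A.subtype) (fun x =>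
      (le_sup_right : A.map f ≤ B ⊔ A.map f) (Submodule.mem_map_of_mem x.2))
  let h := (Submodule.comap (B ⊔ A.map f).subtype B).mkQ ∘ₗ g
  have hs : Function.Surjective h := by
    intro y
    obtain ⟨⟨y, hy⟩, rfl⟩ := Submodule.mkQ_surjective _ y
    obtain ⟨b, hb, z, hz, rfl⟩ := Submodule.mem_sup.mp hy
    obtain ⟨x, hx, rfl⟩ := hz
    refine ⟨⟨x, hx⟩, ?_⟩
    simp only [h, LinearMap.comp_apply, Submodule.mkQ_apply]
    rw [Submodule.Quotient.eq]
    simpa [g] using hb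
  have hk : LinearMap.ker h = Submodule.comap A.subtype (A ⊓ B.comap f) := by
    ext x
    simp [h, g]
  rw [relLen, ← hk]
  exact (h.quotKerEquivOfSurjective hs).length_eq

lemma relLen_sup (B A : Submodule R T) : relLen (A ⊓ B) A = relLen B (A ⊔ B) := by
  have := relLen_map LinearMap.id B A
  rwa [Submodule.comap_id, Submodule.map_id, sup_comm] at this

lemma relLen_self (A : Submodule R T) : relLen A A = 0 := by
  rw [relLen, Module.length_eq_zero_iff]
  simp

/-! ### Families of submodules -/

variable {r : ℕ} {ι : Type*} [DecidableEq ι] (a : ι → R) (d : ι → Fin r)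

/-- stability of a family under the multiplications in `s` -/
def Stab (s : Finset (ι)) (A : (Fin r → ℕ) → Submodule R T) : Prop :=
  ∀ j ∈ s, ∀ n, (A n).map (LinearMap.lsmul R T (a j)) ≤ A (n + Pi.single (d j) 1)

/-- ascending chain condition for stable families between `B` and `A`. -/
def ACC (s : Finset (ι)) (B A : (Fin r → ℕ) → Submodule R T) : Prop :=
  ∀ f : ℕ → (Fin r → ℕ) → Submodule R T, Monotone f → (∀ N, Stab a d s (f N)) →
    (∀ N, B ≤ f N) → (∀ N, f N ≤ A) → ∃ N, ∀ N', N ≤ N' → f N' = f N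

variable {a d}

lemma Stab.mono {s s' : Finset (ι)} (h : s' ⊆ s) {A : (Fin r → ℕ) → Submodule R T}
    (hA : Stab a d s A) : Stab a d s' A := fun j hj => hA j (h hj)

lemma ACC.mono {s : Finset (ι)} {B A B' A' : (Fin r → ℕ) → Submodule R T}
    (h : ACC a d s B A) (hB : B ≤ B') (hA : A' ≤ A) : ACC a d s B' A' :=
  fun f h1 h2 h3 h4 => h f h1 h2 (fun N => hB.trans (h3 N)) (fun N => (h4 N).trans hA)

lemma ACC.erase {s : Finset (ι)} {B A : (Fin r → ℕ) → Submodule R T} {j : ι}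
    (h : ACC a d s B A)
    (hj : ∀ n, (A n).map (LinearMap.lsmul R T (a j)) ≤ B (n + Pi.single (d j) 1)) :
    ACC a d (s.erase j) B A := by
  intro f h1 h2 h3 h4
  refine h f h1 (fun N i hi n => ?_) h3 h4
  by_cases hij : i = j
  · subst hij
    exact (Submodule.map_mono (h4 N n)).trans ((hj n).trans (h3 N _))
  · exact h2 N i (Finset.mem_erase.mpr ⟨hij, hi⟩) n

/-- the kernel family -/
def kerFam (a : ι → R) (d : ι → Fin r) (j : ι)
    (B A : (Fin r → ℕ) → Submodule R T) : (Fin r → ℕ) → Submodule R T :=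
  fun n => A n ⊓ (B (n + Pi.single (d j) 1)).comap (LinearMap.lsmul R T (a j))

/-- the image family -/
def imFam (a : ι → R) (d : ι → Fin r) (j : ι)
    (B A : (Fin r → ℕ) → Submodule R T) : (Fin r → ℕ) → Submodule R T :=
  fun n => B n ⊔ ⨆ m, ⨆ (_ : m + Pi.single (d j) 1 = n), (A m).map (LinearMap.lsmul R T (a j))

lemma imFam_add (j : ι) (B A : (Fin r → ℕ) → Submodule R T) (n : Fin r → ℕ) :
    imFam a d j B A (n + Pi.single (d j) 1) =
      B (n + Pi.single (d j) 1) ⊔ (A n).map (LinearMap.lsmul R T (a j)) := by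
  simp only [imFam, add_left_inj, iSup_iSup_eq_left]

lemma kerFam_stab {s : Finset (ι)} (j : ι) {B A : (Fin r → ℕ) → Submodule R T}
    (hB : Stab a d s B) (hA : Stab a d s A) : Stab a d s (kerFam a d j B A) := by
  rintro i hi n _ ⟨x, ⟨hxA, hxB⟩, rfl⟩
  refine ⟨hA i hi n ⟨x, hxA, rfl⟩, ?_⟩
  have := hB i hi _ ⟨_, hxB, rfl⟩
  simp only [LinearMap.lsmul_apply, SetLike.mem_coe, Submodule.mem_comap] at this ⊢
  rw [smul_comm, add_right_comm]
  exact this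

lemma imFam_stab {s : Finset (ι)} (j : ι) {B A : (Fin r → ℕ) → Submodule R T}
    (hB : Stab a d s B) (hA : Stab a d s A) : Stab a d s (imFam a d j B A) := by
  intro i hi n
  rw [imFam, Submodule.map_sup, sup_le_iff]
  refine ⟨(hB i hi n).trans le_sup_left, ?_⟩
  rw [Submodule.map_iSup, iSup_le_iff]
  intro m
  rw [Submodule.map_iSup, iSup_le_iff]
  rintro rfl
  rw [add_right_comm, imFam_add]
  refine le_trans ?_ le_sup_right
  rintro _ ⟨_, ⟨x, hx, rfl⟩, rfl⟩
  exact ⟨a i • x, hA i hi m ⟨x, hx, rfl⟩, smul_comm _ _ _⟩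

lemma exists_eq_of_no_dir {s : Finset (ι)} {B A : (Fin r → ℕ) → Submodule R T}
    (hB : Stab a d s B) (hA : Stab a d s A) (hBA : B ≤ A) (hacc : ACC a d s B A)
    (i : Fin r) (hi : ∀ j ∈ s, d j ≠ i) : ∃ N, ∀ n : Fin r → ℕ, N ≤ n i → A n = B n := by
  let F : ℕ → (Fin r → ℕ) → Submodule R T := fun N n => if n i < N then A n else B n
  have hF : ∀ N n, F N n = if n i < N then A n else B n := fun _ _ => rfl
  have hex : ∃ N, ∀ N', N ≤ N' → F N' = F N := by
    refine hacc F ?_ ?_ ?_ ?_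
    · intro N N' h n
      by_cases h1 : n i < N
      · have h2 : n i < N' := lt_of_lt_of_le h1 h
        simp [hF, h1, h2]
      · by_cases h2 : n i < N'
        · simpa [hF, h1, h2] using hBA n
        · simp [hF, h1, h2]
    · intro N j hj n
      have : (n + Pi.single (d j) 1 : Fin r → ℕ) i = n i := by
        simp [Pi.single_eq_of_ne (hi j hj).symm]
      rw [hF, hF, this]
      split_ifs
      · exact hA j hj n
      · exact hB j hj n
    · intro N n
      rw [hF]
      split_ifs
      · exact hBA n
      · rfl
    · intro N n
      rw [hF]
      split_ifs
      · rfl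
      · exact hBA n
  obtain ⟨N, hN⟩ := hex
  refine ⟨N, fun n hn => ?_⟩
  have := congrFun (hN (n i + 1) (by omega)) n
  simpa [hF, not_lt.mpr hn] using this

theorem evPoly_relLen (s : Finset (ι)) : ∀ (B A : (Fin r → ℕ) → Submodule R T),
    Stab a d s B → Stab a d s A → B ≤ A → ACC a d s B A →
    (∃ c, ∀ n, c ≤ n → relLen (B n) (A n) ≠ ⊤) →
    EvPoly (fun n => ((relLen (B n) (A n)).toNat : ℚ)) := by
  induction s using Finset.strongInduction with
  | H s ih =>
  intro B A hB hA hBA hacc hfin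
  by_cases hdir : ∃ i, ∀ j ∈ s, d j ≠ i
  · obtain ⟨i, hi⟩ := hdir
    obtain ⟨N, hN⟩ := exists_eq_of_no_dir hB hA hBA hacc i hi
    refine ⟨Pi.single i N, _, IsPolyFun.const 0, fun n hn => ?_⟩
    have := hN n (by simpa using hn i)
    simp [this, relLen_self]
  push Not at hdir
  obtain ⟨c, hc⟩ := hfin
  refine EvPoly.of_diff _ fun i => ?_
  obtain ⟨j, hj, rfl⟩ := hdir i
  have hK1 : B ≤ kerFam a d j B A := fun n =>
    le_inf (hBA n) (Submodule.map_le_iff_le_comap.mp (hB j hj n))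
  have hK2 : kerFam a d j B A ≤ A := fun n => inf_le_left
  have hC1 : B ≤ imFam a d j B A := fun n => le_sup_left
  have hC2 : imFam a d j B A ≤ A := by
    intro n
    refine sup_le (hBA n) (iSup_le fun m => iSup_le ?_)
    rintro rfl
    exact hA j hj m
  have hss := Finset.erase_ssubset hj
  have e1 := fun n => relLen_add (hK1 n) (hK2 n)
  have e2 := fun n => relLen_add (hC1 n) (hC2 n)
  have p1 : EvPoly (fun n => ((relLen (B n) (kerFam a d j B A n)).toNat : ℚ)) := by
    refine ih _ hss _ _ (hB.mono hss.1) ((kerFam_stab j hB hA).mono hss.1) hK1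
      ((hacc.mono le_rfl hK2).erase fun n => ?_) ⟨c, fun n hn h => hc n hn ?_⟩
    · rw [Submodule.map_le_iff_le_comap]
      exact inf_le_right
    · rw [e1, h, top_add]
  have p2 : EvPoly (fun n => ((relLen (imFam a d j B A n) (A n)).toNat : ℚ)) := by
    refine ih _ hss _ _ ((imFam_stab j hB hA).mono hss.1) (hA.mono hss.1) hC2
      ((hacc.mono hC1 le_rfl).erase fun n => ?_) ⟨c, fun n hn h => hc n hn ?_⟩
    · rw [imFam_add]
      exact le_sup_right
    · rw [e2, h, add_top]
  refine ((p2.shift (Pi.single (d j) 1)).sub p1).congr' c fun n hn => ?_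
  have hn' : c ≤ n + Pi.single (d j) 1 := hn.trans (le_add_of_nonneg_right zero_le)
  have f1 := hc n hn
  have f2 := hc _ hn'
  have e3 : relLen (kerFam a d j B A n) (A n) = relLen (B (n + Pi.single (d j) 1))
      (imFam a d j B A (n + Pi.single (d j) 1)) := by
    rw [imFam_add]
    exact relLen_map _ _ _
  rw [e1] at f1
  rw [e2] at f2
  beta_reduce
  rw [e1 n, e2 (n + _), ← e3]
  rw [← e3] at f2
  obtain ⟨g1, g2⟩ : relLen (B n) (kerFam a d j B A n) ≠ ⊤ ∧
      relLen (kerFam a d j B A n) (A n) ≠ ⊤ := by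
    simpa using f1
  have g3 : relLen (imFam a d j B A (n + Pi.single (d j) 1)) (A (n + Pi.single (d j) 1)) ≠ ⊤ :=
    fun h => f2 (by rw [h, add_top])
  rw [ENat.toNat_add g1 g2, ENat.toNat_add g2 g3]
  push_cast
  ring

end RelLength

/-! ### The Hilbert basis theorem input -/

section Hilbert
variable {R T : Type*} [CommRing R] [AddCommGroup T] [Module R T]
variable {r : ℕ} {ι : Type*} [DecidableEq ι] (a : ι → R) (d : ι → Fin r)

/-- The map onto the multi-Rees algebra. -/
noncomputable def reesMap : MvPolynomial ι R →ₐ[R] MvPolynomial (Fin r) R :=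
  MvPolynomial.aeval (fun j => MvPolynomial.monomial (Finsupp.single (d j) 1) (a j))

/-- Coefficients in degree `n` of the image of `reesMap`. -/
noncomputable def reesCoeff (n : Fin r →₀ ℕ) : Ideal R :=
  Submodule.comap (MvPolynomial.monomial n) (Subalgebra.toSubmodule (reesMap a d).range)

lemma mem_reesCoeff {n : Fin r →₀ ℕ} {p : R} :
    p ∈ reesCoeff a d n ↔ ∃ g, reesMap a d g = MvPolynomial.monomial n p := Iff.rfl

lemma one_le_reesCoeff : (1 : Ideal R) ≤ reesCoeff a d 0 := by
  intro p _
  rw [mem_reesCoeff]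
  exact ⟨MvPolynomial.C p, by simp [reesMap]⟩

lemma reesCoeff_mul (m n : Fin r →₀ ℕ) :
    reesCoeff a d m * reesCoeff a d n ≤ reesCoeff a d (m + n) := by
  rw [Ideal.mul_le]
  intro p hp q hq
  rw [mem_reesCoeff] at *
  obtain ⟨f, hf⟩ := hp
  obtain ⟨g, hg⟩ := hq
  exact ⟨f * g, by rw [map_mul, hf, hg, MvPolynomial.monomial_mul]⟩

lemma le_reesCoeff_pow {I : Ideal R} {m : Fin r →₀ ℕ} (h : I ≤ reesCoeff a d m) (k : ℕ) :
    I ^ k ≤ reesCoeff a d (k • m) := by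
  induction k with
  | zero => simpa using one_le_reesCoeff a d
  | succ k ih =>
    rw [pow_succ, succ_nsmul]
    exact (Ideal.mul_mono ih h).trans (reesCoeff_mul a d _ _)

lemma prodPow_le_reesCoeff {I : Fin r → Ideal R}
    (hI : ∀ i, I i ≤ Ideal.span (a '' {j | d j = i})) (n : Fin r →₀ ℕ) :
    prodPow I n ≤ reesCoeff a d n := by
  have h1 : ∀ i, I i ≤ reesCoeff a d (Finsupp.single i 1) := by
    intro i
    refine (hI i).trans (Ideal.span_le.mpr ?_)
    rintro _ ⟨j, rfl, rfl⟩
    exact (mem_reesCoeff a d).mpr ⟨MvPolynomial.X j, by simp [reesMap]⟩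
  have h2 : ∀ s : Finset (Fin r), ∏ i ∈ s, I i ^ n i ≤
      reesCoeff a d (∑ i ∈ s, n i • Finsupp.single i 1) := by
    intro s
    induction s using Finset.induction_on with
    | empty => simpa using one_le_reesCoeff a d
    | insert i s his ih =>
      rw [Finset.prod_insert his, Finset.sum_insert his]
      exact (Ideal.mul_mono (le_reesCoeff_pow a d (h1 i) _) ih).trans (reesCoeff_mul a d _ _)
  refine (h2 Finset.univ).trans (le_of_eq ?_)
  congr 1
  ext j
  simp [Finsupp.single_apply]

/-- the degree `n` evaluation map -/
noncomputable def evalDeg {q : ℕ} (v : Fin q → T) (n : Fin r →₀ ℕ)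
    (f : Fin q → MvPolynomial ι R) : T :=
  ∑ l, MvPolynomial.coeff n (reesMap a d (f l)) • v l

/-- The submodule attached to a stable family. -/
noncomputable def famSub [Fintype ι] {q : ℕ} (v : Fin q → T) (C : (Fin r → ℕ) → Submodule R T)
    (hC : Stab a d Finset.univ C) :
    Submodule (MvPolynomial ι R) (Fin q → MvPolynomial ι R) where
  carrier := {f | ∀ n : Fin r →₀ ℕ, evalDeg a d v n f ∈ C n}
  zero_mem' n := by simp [evalDeg]
  add_mem' {f g} hf hg n := by
    have := add_mem (hf n) (hg n)
    simpa [evalDeg, add_smul, Finset.sum_add_distrib] using this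
  smul_mem' p f hf := by
    induction p using MvPolynomial.induction_on generalizing f with
    | C x =>
      intro n
      have := (C n).smul_mem x (hf n)
      have e : reesMap a d (MvPolynomial.C x) = MvPolynomial.C x := by
        simp [reesMap]
      simpa [evalDeg, Finset.smul_sum, mul_smul, e, MvPolynomial.coeff_C_mul] using this
    | add p q hp hq =>
      intro n
      have := add_mem (hp f hf n) (hq f hf n)
      simpa [evalDeg, add_mul, add_smul, Finset.sum_add_distrib] using this
    | mul_X p j hp =>
      rw [mul_smul]
      refine hp _ fun n => ?_
      have e : reesMap a d (MvPolynomial.X j) =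
        MvPolynomial.monomial (Finsupp.single (d j) 1) (a j) := by simp [reesMap]
      by_cases hn : Finsupp.single (d j) 1 ≤ n
      · obtain ⟨m, rfl⟩ := exists_add_of_le hn
        have := hC j (Finset.mem_univ _) m ⟨_, hf m, rfl⟩
        have e2 : (⇑((Finsupp.single (d j) 1 : Fin r →₀ ℕ) + m) : Fin r → ℕ) = ⇑m + Pi.single (d j) 1 := by
          rw [Finsupp.coe_add, add_comm, Finsupp.single_eq_pi_single]
        rw [e2]
        have e3 : evalDeg a d v (Finsupp.single (d j) 1 + m) ((MvPolynomial.X j : MvPolynomial ι R) • f) =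
            a j • evalDeg a d v m f := by
          simp only [evalDeg, Finset.smul_sum, Pi.smul_apply, smul_eq_mul, map_mul, e,
            MvPolynomial.coeff_monomial_mul, mul_smul]
        rw [e3]
        exact this
      · simp [evalDeg, e, MvPolynomial.coeff_monomial_mul', hn]

lemma mem_famSub [Fintype ι] {q : ℕ} (v : Fin q → T) {C : (Fin r → ℕ) → Submodule R T}
    (hC : Stab a d Finset.univ C) {f : Fin q → MvPolynomial ι R} :
    f ∈ famSub a d v C hC ↔ ∀ n : Fin r →₀ ℕ, evalDeg a d v n f ∈ C n := Iff.rfl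

lemma exists_lift {I : Fin r → Ideal R}
    (hI : ∀ i, I i ≤ Ideal.span (a '' {j | d j = i})) {q : ℕ} (v : Fin q → T)
    (n : Fin r →₀ ℕ) {x : T} (hx : x ∈ prodPow I n • Submodule.span R (Set.range v)) :
    ∃ f : Fin q → MvPolynomial ι R, ∀ m, evalDeg a d v m f = if m = n then x else 0 := by
  induction hx using Submodule.smul_induction_on' with
  | smul p hp y hy =>
    obtain ⟨g, hg⟩ := (mem_reesCoeff a d).mp (prodPow_le_reesCoeff a d hI n hp)
    obtain ⟨c, rfl⟩ := (Submodule.mem_span_range_iff_exists_fun R).mp hy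
    refine ⟨fun l => c l • g, fun m => ?_⟩
    simp only [evalDeg, map_smul, hg, MvPolynomial.coeff_smul, MvPolynomial.coeff_monomial]
    by_cases h : m = n
    · subst h
      simp [Finset.smul_sum, smul_smul, mul_comm]
    · simp [h, Ne.symm h]
  | add x hx y hy h1 h2 =>
    obtain ⟨f, hf⟩ := h1
    obtain ⟨g, hg⟩ := h2
    refine ⟨f + g, fun m => ?_⟩
    have : evalDeg a d v m (f + g) = evalDeg a d v m f + evalDeg a d v m g := by
      simp [evalDeg, add_smul, Finset.sum_add_distrib]
    rw [this, hf, hg]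
    split_ifs <;> simp

lemma acc_prodPow [IsNoetherianRing R] [Fintype ι] {I : Fin r → Ideal R}
    (hI : ∀ i, I i ≤ Ideal.span (a '' {j | d j = i})) (V : Submodule R T) (hV : V.FG)
    (B : (Fin r → ℕ) → Submodule R T) :
    ACC a d Finset.univ B (fun n => prodPow I n • V) := by
  obtain ⟨q, v, rfl⟩ := Submodule.fg_iff_exists_fin_generating_family.mp hV
  intro f hmono hst _ hle
  obtain ⟨N, hN⟩ := monotone_stabilizes_iff_noetherian.mpr
    (inferInstance : IsNoetherian (MvPolynomial ι R) (Fin q → MvPolynomial ι R))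
    ⟨fun N => famSub a d v (f N) (hst N), fun N N' h g hg n => hmono h _ (hg n)⟩
  refine ⟨N, fun N' h => le_antisymm ?_ (hmono h)⟩
  intro n x hx
  obtain ⟨n, rfl⟩ := Finsupp.equivFunOnFinite.surjective n
  obtain ⟨g, hg⟩ := exists_lift a d hI v n (hle N' _ hx)
  have h1 : g ∈ famSub a d v (f N') (hst N') := by
    intro m
    rw [hg]
    split_ifs with hm
    · subst hm; exact hx
    · exact zero_mem _
  have h2 : famSub a d v (f N) (hst N) = famSub a d v (f N') (hst N') := hN N' h
  rw [← h2] at h1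
  have := h1 n
  rw [hg, if_pos rfl] at this
  exact this

lemma stab_prodPow {I : Fin r → Ideal R} (ha : ∀ j, a j ∈ I (d j)) (s : Finset ι)
    (V : Submodule R T) : Stab a d s (fun n => prodPow I n • V) := by
  rintro j _ n _ ⟨x, hx, rfl⟩
  have e : prodPow I (n + Pi.single (d j) 1) = I (d j) * prodPow I n := by
    simp only [prodPow, Pi.add_apply, pow_add, Finset.prod_mul_distrib]
    rw [mul_comm]
    congr 1
    rw [Finset.prod_eq_single (d j)]
    · simp
    · intro i _ hi
      simp [Pi.single_eq_of_ne hi]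
    · simp
  beta_reduce
  rw [e, ← smul_eq_mul, Submodule.smul_assoc]
  exact Submodule.smul_mem_smul (ha j) hx

lemma prodPow_anti (I : Fin r → Ideal R) (n e : Fin r → ℕ) :
    prodPow I (n + e) ≤ prodPow I n := by
  simp only [prodPow, Pi.add_apply, pow_add, Finset.prod_mul_distrib]
  exact Ideal.mul_le_left (I := ∏ i, I i ^ n i) (J := ∏ i, I i ^ e i)

end Hilbert

lemma moduleLength_eq (R X : Type*) [CommRing R] [AddCommGroup X] [Module R X] :
    moduleLength R X = (Module.length R X : WithBot ℕ∞) := (Module.coe_length R X).symm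

/-- if `L_n := (U + IⁿV)/(IⁿW)` (with `U, V, W` finitely generated
submodules of `T`, `W ⊆ V`) has finite length for all `n ≫ 0`, then `λ_R(L_n)` is
eventually given by a polynomial in `n`. -/
theorem stmt10 {R : Type*} [CommRing R] [IsNoetherianRing R]
    {r : ℕ} (hr : 1 ≤ r) (I : Fin r → Ideal R)
    (T : Type*) [AddCommGroup T] [Module R T]
    (U V W : Submodule R T) (hU : U.FG) (hV : V.FG) (hW : W.FG) (hWV : W ≤ V)
    (hfin : ∃ c₀ : Fin r → ℕ, ∀ n : Fin r → ℕ, c₀ ≤ n →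
      moduleLength R
        (↥(U ⊔ prodPow I n • V) ⧸
          Submodule.comap (U ⊔ prodPow I n • V).subtype (prodPow I n • W)) ≠ ⊤) :
    ∃ (c : Fin r → ℕ) (P : MvPolynomial (Fin r) ℚ), ∀ n : Fin r → ℕ, c ≤ n →
      ∃ m : ℕ,
        moduleLength R
          (↥(U ⊔ prodPow I n • V) ⧸
            Submodule.comap (U ⊔ prodPow I n • V).subtype (prodPow I n • W)) = m ∧
        (m : ℚ) = MvPolynomial.eval (fun i => (n i : ℚ)) P := by
  obtain ⟨c₀, hfin⟩ := hfin
  have hfin : ∀ n, c₀ ≤ n → relLen (prodPow I n • W) (U ⊔ prodPow I n • V) ≠ ⊤ := by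
    intro n hn h
    apply hfin n hn
    rw [moduleLength_eq]
    exact congrArg _ h
  -- generators
  have hg : ∀ i, ∃ (m : ℕ) (g : Fin m → R), Ideal.span (Set.range g) = I i := fun i =>
    Submodule.fg_iff_exists_fin_generating_family.mp (IsNoetherian.noetherian (I i))
  choose m g hg using hg
  let a : (Σ i, Fin (m i)) → R := fun j => g j.1 j.2
  let d : (Σ i, Fin (m i)) → Fin r := fun j => j.1
  have ha : ∀ j, a j ∈ I (d j) := fun j => by
    rw [← hg]
    exact Ideal.subset_span ⟨_, rfl⟩
  have hI : ∀ i, I i ≤ Ideal.span (a '' {j | d j = i}) := by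
    intro i
    rw [← hg]
    apply Ideal.span_mono
    rintro _ ⟨l, rfl⟩
    exact ⟨⟨i, l⟩, rfl, rfl⟩
  have hVW : ∀ n, prodPow I n • W ≤ prodPow I n • V := fun n => Submodule.smul_mono le_rfl hWV
  have e1 := fun n => relLen_add (hVW n) (le_sup_right : prodPow I n • V ≤ U ⊔ prodPow I n • V)
  have f1 : ∀ n, c₀ ≤ n → relLen (prodPow I n • W) (prodPow I n • V) ≠ ⊤ := fun n hn h =>
    hfin n hn (by rw [e1, h, top_add])
  have f2 : ∀ n, c₀ ≤ n → relLen (U ⊓ prodPow I n • V) U ≠ ⊤ := fun n hn h =>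
    hfin n hn (by rw [e1, ← relLen_sup, h, add_top])
  have stV := stab_prodPow a d ha Finset.univ V
  have stW := stab_prodPow a d ha Finset.univ W
  have p1 := evPoly_relLen (a := a) (d := d) Finset.univ _ _ stW stV hVW
    (acc_prodPow a d hI V hV _) ⟨c₀, f1⟩
  have p2 : EvPoly (fun n => ((relLen (U ⊓ prodPow I n • V) U).toNat : ℚ)) := by
    refine EvPoly.of_diff _ fun i => ?_
    have stD : Stab a d Finset.univ (fun n => U ⊓ prodPow I n • V) := by
      rintro j hj n _ ⟨x, ⟨hxU, hxV⟩, rfl⟩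
      exact ⟨U.smul_mem _ hxU, stV j hj n ⟨x, hxV, rfl⟩⟩
    have stD' : Stab a d Finset.univ (fun n => U ⊓ prodPow I (n + Pi.single i 1) • V) := by
      intro j hj n
      have := stD j hj (n + Pi.single i 1)
      beta_reduce at this ⊢
      rwa [add_right_comm] at this
    have hle : ∀ n, U ⊓ prodPow I (n + Pi.single i 1) • V ≤ U ⊓ prodPow I n • V := fun n =>
      inf_le_inf_left _ (Submodule.smul_mono_left (prodPow_anti I n _))
    have e2 := fun n => relLen_add (hle n) (inf_le_left : U ⊓ prodPow I n • V ≤ U)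
    have hadd : ∀ n, c₀ ≤ n → c₀ ≤ n + Pi.single i 1 := fun n hn =>
      hn.trans (le_add_of_nonneg_right zero_le)
    have f3 : ∀ n, c₀ ≤ n → relLen (U ⊓ prodPow I (n + Pi.single i 1) • V)
        (U ⊓ prodPow I n • V) ≠ ⊤ := fun n hn h =>
      f2 _ (hadd n hn) (by rw [e2, h, top_add])
    refine (evPoly_relLen (a := a) (d := d) Finset.univ _ _ stD' stD hle
      ((acc_prodPow a d hI V hV _).mono le_rfl (fun n => inf_le_right)) ⟨c₀, f3⟩).congr' c₀ ?_
    intro n hn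
    beta_reduce
    rw [e2 n, ENat.toNat_add (f3 n hn) (f2 n hn)]
    push_cast
    ring
  obtain ⟨c, F, ⟨P, hP⟩, h⟩ := p1.add p2
  refine ⟨c ⊔ c₀, P, fun n hn => ?_⟩
  have hn0 : c₀ ≤ n := le_sup_right.trans hn
  refine ⟨(relLen (prodPow I n • W) (U ⊔ prodPow I n • V)).toNat, ?_, ?_⟩
  · rw [moduleLength_eq]
    have := ENat.natCast_toNat (hfin n hn0)
    exact congrArg (WithBot.some) this.symm
  · have h := h n (le_sup_left.trans hn)
    rw [← hP, ← h, e1, ← relLen_sup, ENat.toNat_add (f1 n hn0) (f2 n hn0)]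
    push_cast
    rfl
end

section
/- Let R be a commutative Noetherian ring, r ≥ 1 an integer, and I_1,…,I_r ideals of R. Let ψ : B → C be an R-linear map between finitely generated R-modules and let C' be a submodule of C. Then there exists d ∈ ℕ^r such that for all n ∈ ℕ^r with n ≥ d, the preimage satisfies ψ^{-1}(I^n C') = ker(ψ) + I^{n−d}·(ψ^{-1}(I^d C')) (an equality of submodules of B). -/
theorem prodPow_add' {R : Type*} [CommRing R] {r : ℕ} (I : Fin r → Ideal R)
    (m n : Fin r → ℕ) : prodPow I (m + n) = prodPow I m * prodPow I n := by
  simp [prodPow, pow_add, Finset.prod_mul_distrib]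

theorem prodPow_zero' {R : Type*} [CommRing R] {r : ℕ} (I : Fin r → Ideal R) :
    prodPow I 0 = 1 := by
  simp [prodPow]

theorem prodPow_single' {R : Type*} [CommRing R] {r : ℕ} (I : Fin r → Ideal R) (i : Fin r) :
    prodPow I (Pi.single i 1) = I i := by
  rw [prodPow, Finset.prod_eq_single i]
  · simp
  · intro b _ hb
    simp [Pi.single_eq_of_ne hb]
  · simp

/-- Evaluations of homogeneous polynomials form an ideal. -/
noncomputable def evalIdeal {R σ : Type*} [CommRing R] {r : ℕ} (w : σ → Fin r → ℕ) (a : σ → R)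
    (n : Fin r → ℕ) : Ideal R :=
  (MvPolynomial.weightedHomogeneousSubmodule R w n).map (MvPolynomial.aeval a).toLinearMap

theorem mem_evalIdeal {R σ : Type*} [CommRing R] {r : ℕ} {w : σ → Fin r → ℕ} {a : σ → R}
    {n : Fin r → ℕ} {x : R} : x ∈ evalIdeal w a n ↔
      ∃ p : MvPolynomial σ R, p.IsWeightedHomogeneous w n ∧ MvPolynomial.aeval a p = x := by
  simp [evalIdeal, Submodule.mem_map, MvPolynomial.mem_weightedHomogeneousSubmodule]

theorem evalIdeal_mul {R σ : Type*} [CommRing R] {r : ℕ} (w : σ → Fin r → ℕ) (a : σ → R)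
    (m n : Fin r → ℕ) : evalIdeal w a m * evalIdeal w a n ≤ evalIdeal w a (m + n) := by
  rw [Ideal.mul_le]
  intro x hx y hy
  obtain ⟨p, hp, rfl⟩ := mem_evalIdeal.1 hx
  obtain ⟨q, hq, rfl⟩ := mem_evalIdeal.1 hy
  exact mem_evalIdeal.2 ⟨p * q, hp.mul hq, by simp⟩

theorem evalIdeal_zero {R σ : Type*} [CommRing R] {r : ℕ} (w : σ → Fin r → ℕ) (a : σ → R) :
    1 ≤ evalIdeal w a 0 := by
  rw [Ideal.one_eq_top, top_le_iff, Ideal.eq_top_iff_one]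
  exact mem_evalIdeal.2 ⟨1, MvPolynomial.isWeightedHomogeneous_one R w, by simp⟩

theorem prodPow_le_evalIdeal {R σ : Type*} [CommRing R] {r : ℕ} (I : Fin r → Ideal R)
    (w : σ → Fin r → ℕ) (a : σ → R)
    (h : ∀ i, I i ≤ evalIdeal w a (Pi.single i 1)) (n : Fin r → ℕ) :
    prodPow I n ≤ evalIdeal w a n := by
  have h1 : ∀ i (k : ℕ), I i ^ k ≤ evalIdeal w a (k • Pi.single i 1) := by
    intro i k
    induction k with
    | zero => simpa using evalIdeal_zero w a
    | succ k ih =>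
      rw [pow_succ, succ_nsmul]
      exact (Ideal.mul_mono ih (h i)).trans (evalIdeal_mul w a _ _)
  have h2 : ∀ s : Finset (Fin r),
      ∏ i ∈ s, I i ^ n i ≤ evalIdeal w a (∑ i ∈ s, n i • Pi.single i 1) := by
    intro s
    classical
    induction s using Finset.induction_on with
    | empty => simpa using evalIdeal_zero w a
    | insert i s hi ih =>
      rw [Finset.prod_insert hi, Finset.sum_insert hi]
      exact (Ideal.mul_mono (h1 _ _) ih).trans (evalIdeal_mul w a _ _)
  have h3 : ∑ i, n i • (Pi.single i 1 : Fin r → ℕ) = n := by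
    ext j
    simp [Finset.sum_apply, Pi.single_apply]
  have := h2 Finset.univ
  rwa [h3] at this

theorem aeval_monomial_mem {R σ : Type*} [CommRing R] {r : ℕ} (I : Fin r → Ideal R)
    (w : σ → Fin r → ℕ) (a : σ → R) (h : ∀ s, a s ∈ prodPow I (w s)) (s : σ →₀ ℕ) (b : R) :
    MvPolynomial.aeval a (MvPolynomial.monomial s b) ∈ prodPow I (Finsupp.weight w s) := by
  rw [MvPolynomial.aeval_monomial]
  apply Ideal.mul_mem_left
  have hk : ∀ i (k : ℕ), a i ^ k ∈ prodPow I (k • w i) := by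
    intro i k
    induction k with
    | zero => simp [prodPow_zero']
    | succ k ih =>
      rw [pow_succ, succ_nsmul, prodPow_add']
      exact Ideal.mul_mem_mul ih (h i)
  rw [Finsupp.weight_apply, Finsupp.prod, Finsupp.sum]
  classical
  induction s.support using Finset.induction_on with
  | empty => simp [prodPow_zero']
  | insert i t hi ih =>
    rw [Finset.prod_insert hi, Finset.sum_insert hi, prodPow_add']
    exact Ideal.mul_mem_mul (hk _ _) ih

theorem aeval_mem_prodPow {R σ : Type*} [CommRing R] {r : ℕ} (I : Fin r → Ideal R)
    (w : σ → Fin r → ℕ) (a : σ → R) (h : ∀ s, a s ∈ prodPow I (w s)) {n : Fin r → ℕ}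
    {p : MvPolynomial σ R} (hp : p.IsWeightedHomogeneous w n) :
    MvPolynomial.aeval a p ∈ prodPow I n := by
  rw [p.as_sum, map_sum]
  refine Ideal.sum_mem _ fun s hs => ?_
  have := aeval_monomial_mem I w a h s (p.coeff s)
  rwa [hp (MvPolynomial.mem_support_iff.1 hs)] at this

/-- Multi-ideal Artin–Rees. -/
theorem multi_artin_rees {R : Type*} [CommRing R] [IsNoetherianRing R]
    {r : ℕ} (I : Fin r → Ideal R) {C : Type*}
    [AddCommGroup C] [Module R C] [Module.Finite R C] (C' N : Submodule R C) :
    ∃ d : Fin r → ℕ, ∀ n : Fin r → ℕ, d ≤ n →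
      prodPow I n • C' ⊓ N ≤ prodPow I (n - d) • (prodPow I d • C' ⊓ N) := by
  classical
  have hG : ∀ i, ∃ G : Finset R, Ideal.span (G : Set R) = I i :=
    fun i => IsNoetherian.noetherian (I i)
  choose G hG using hG
  let σ := Σ i, (G i : Finset R)
  let w : σ → Fin r → ℕ := fun s => Pi.single s.1 1
  let a : σ → R := fun s => s.2
  have ha : ∀ s, a s ∈ prodPow I (w s) := by
    intro s
    rw [prodPow_single', ← hG]
    exact Ideal.subset_span s.2.2
  have hIe : ∀ i, I i ≤ evalIdeal w a (Pi.single i 1) := by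
    intro i
    rw [← hG, Ideal.span_le]
    intro x hx
    refine mem_evalIdeal.2 ⟨MvPolynomial.X (⟨i, ⟨x, hx⟩⟩ : σ), ?_, by simp [a]⟩
    exact MvPolynomial.isWeightedHomogeneous_X R w _
  obtain ⟨m, c, hc⟩ := Submodule.fg_iff_exists_fin_generating_family.1
    (IsNoetherian.noetherian C')
  let S := MvPolynomial σ R
  let e : (Fin m → S) →ₗ[R] C :=
    ∑ j, ((MvPolynomial.aeval a).toLinearMap.smulRight (c j)).comp (LinearMap.proj j)
  have he : ∀ f, e f = ∑ j, MvPolynomial.aeval a (f j) • c j := by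
    intro f; simp [e]
  have hes : ∀ (h : S) f, e (h • f) = MvPolynomial.aeval a h • e f := by
    intro h f
    simp [he, Finset.smul_sum, mul_smul]
  have he1 : ∀ n f, (∀ j, (f j).IsWeightedHomogeneous w n) → e f ∈ prodPow I n • C' := by
    intro n f hf
    rw [he]
    refine Submodule.sum_mem _ fun j _ => Submodule.smul_mem_smul
      (aeval_mem_prodPow I w a ha (hf j)) ?_
    rw [← hc]
    exact Submodule.subset_span ⟨j, rfl⟩
  have he2 : ∀ n, ∀ x ∈ prodPow I n • C',
      ∃ f, (∀ j, (f j).IsWeightedHomogeneous w n) ∧ e f = x := by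
    intro n x hx
    induction hx using Submodule.smul_induction_on' with
    | smul b hb y hy =>
      obtain ⟨p, hp, rfl⟩ := mem_evalIdeal.1 (prodPow_le_evalIdeal I w a hIe n hb)
      rw [← hc] at hy
      obtain ⟨t, rfl⟩ := (Submodule.mem_span_range_iff_exists_fun R).1 hy
      refine ⟨fun j => t j • p, fun j => ?_, ?_⟩
      · exact (MvPolynomial.weightedHomogeneousSubmodule R w n).smul_mem (t j) hp
      · rw [he, Finset.smul_sum]
        refine Finset.sum_congr rfl fun j _ => ?_
        rw [map_smul, smul_assoc, smul_comm]
    | add x hx y hy ihx ihy =>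
      obtain ⟨f, hf, rfl⟩ := ihx
      obtain ⟨g, hg, rfl⟩ := ihy
      exact ⟨f + g, fun j => (hf j).add (hg j), by simp⟩
  let P : Set (Fin m → S) :=
    {f | ∃ n, (∀ j, (f j).IsWeightedHomogeneous w n) ∧ e f ∈ N}
  have hfg : (Submodule.span S P).FG := IsNoetherian.noetherian _
  obtain ⟨T, hTP, hT⟩ := Submodule.fg_span_iff_fg_span_finset_subset P |>.1 hfg
  have hTP2 : ∀ f ∈ T, ∃ n, (∀ j, (f j).IsWeightedHomogeneous w n) ∧ e f ∈ N :=
    fun f hf => hTP hf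
  choose! deg hdeg using hTP2
  let d : Fin r → ℕ := T.sup deg
  refine ⟨d, fun n hn x hx => ?_⟩
  obtain ⟨f, hf, rfl⟩ := he2 n x hx.1
  have hfK : f ∈ Submodule.span S (T : Set (Fin m → S)) := by
    rw [← hT]
    exact Submodule.subset_span ⟨n, hf, hx.2⟩
  let comp : (Fin m → S) →ₗ[R] (Fin m → S) :=
    LinearMap.pi fun j => (MvPolynomial.weightedHomogeneousComponent w n).comp (LinearMap.proj j)
  have hcomp : ∀ g j, comp g j = MvPolynomial.weightedHomogeneousComponent w n (g j) := by
    intro g j; rfl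
  have hc1 : ∀ g k, (∀ j, (g j).IsWeightedHomogeneous w k) → comp g = if k = n then g else 0 := by
    intro g k hg
    ext1 j
    rw [hcomp]
    split_ifs with h
    · subst h
      exact MvPolynomial.weightedHomogeneousComponent_eq_self (hg j)
    · rw [MvPolynomial.weightedHomogeneousComponent_of_mem (hg j), if_neg (Ne.symm h)]
      rfl
  have hmon : ∀ g ∈ T, ∀ h : S, e (comp (h • g)) ∈
      prodPow I (n - d) • (prodPow I d • C' ⊓ N) := by
    intro g hg h
    obtain ⟨hg1, hg2⟩ := hdeg g hg
    have hgd : deg g ≤ d := Finset.le_sup hg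
    induction h using MvPolynomial.induction_on' with
    | monomial s b =>
      rw [hc1 ((MvPolynomial.monomial s b : S) • g) (Finsupp.weight w s + deg g) (fun j =>
        (MvPolynomial.isWeightedHomogeneous_monomial w s b rfl).mul (hg1 j))]
      split_ifs with hs
      · rw [hes]
        have h1 := aeval_monomial_mem I w a ha s b
        have h2 : Finsupp.weight w s = (n - d) + (d - deg g) := by
          ext i
          have := congrFun hs i
          have := hn i
          have := hgd i
          simp only [Pi.add_apply, Pi.sub_apply] at *
          omega
        rw [h2, prodPow_add'] at h1
        have h3 := Submodule.smul_mem_smul h1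
          (show e g ∈ prodPow I (deg g) • C' ⊓ N from ⟨he1 _ _ hg1, hg2⟩)
        rw [Submodule.mul_smul] at h3
        refine Submodule.smul_mono le_rfl (le_inf ?_ ?_) h3
        · refine (Submodule.smul_mono le_rfl inf_le_left).trans ?_
          rw [← Submodule.mul_smul, ← prodPow_add', tsub_add_cancel_of_le hgd]
        · exact (Submodule.smul_mono le_rfl inf_le_right).trans Submodule.smul_le_right
      · simp
    | add p q hp hq =>
      rw [add_smul, map_add, map_add]
      exact add_mem hp hq
  have hfin : e (comp f) ∈ prodPow I (n - d) • (prodPow I d • C' ⊓ N) := by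
    obtain ⟨h, _, rfl⟩ := Submodule.mem_span_finset.1 hfK
    rw [map_sum, map_sum]
    exact Submodule.sum_mem _ fun g hg => hmon g hg _
  rwa [hc1 f n hf, if_pos rfl] at hfin

/-- (an Artin–Rees type lemma) there exists `d ∈ ℕ^r` such that for all
`n ≥ d` one has `ψ⁻¹(Iⁿ C') = ker ψ + I^{n−d} · ψ⁻¹(I^d C')`. -/
theorem stmt17 {R : Type*} [CommRing R] [IsNoetherianRing R]
    {r : ℕ} (hr : 1 ≤ r) (I : Fin r → Ideal R)
    {B C : Type*}
    [AddCommGroup B] [Module R B] [Module.Finite R B]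
    [AddCommGroup C] [Module R C] [Module.Finite R C]
    (ψ : B →ₗ[R] C) (C' : Submodule R C) :
    ∃ d : Fin r → ℕ, ∀ n : Fin r → ℕ, d ≤ n →
      Submodule.comap ψ (prodPow I n • C') =
        LinearMap.ker ψ ⊔ prodPow I (n - d) • Submodule.comap ψ (prodPow I d • C') := by
  obtain ⟨d, hd⟩ := multi_artin_rees I C' (LinearMap.range ψ)
  refine ⟨d, fun n hn => le_antisymm ?_ (sup_le ?_ ?_)⟩
  · intro x hx
    have h := hd n hn (show ψ x ∈ _ from ⟨hx, ⟨x, rfl⟩⟩)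
    rw [inf_comm, ← Submodule.map_comap_eq, ← Submodule.map_smul''] at h
    obtain ⟨y, hy, hyx⟩ := h
    refine Submodule.mem_sup.2 ⟨x - y, ?_, y, hy, by simp⟩
    simp [hyx]
  · intro x hx
    rw [Submodule.mem_comap, LinearMap.mem_ker.1 hx]
    exact zero_mem _
  · rw [← Submodule.map_le_iff_le_comap, Submodule.map_smul'']
    refine (Submodule.smul_mono le_rfl (Submodule.map_comap_le _ _)).trans ?_
    rw [← Submodule.mul_smul, ← prodPow_add', tsub_add_cancel_of_le hn]
end
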